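/- Let d ≥ 1, let 𝓜 be a compact subset of the d×d real symmetric matrices, and for each ε > 0 let 𝓤_ε := { R(I + εU + r(ε,U)) : R ∈ SO(d), U ∈ 𝓜 }, where r(ε,U) is a symmetric-matrix-valued remainder satisfying sup_{U ∈ 𝓜} ‖r(ε,U)‖/ε → 0 as ε → 0⁺. Then for every d×d real symmetric matrix E, lim_{ε→0⁺} (1/ε²)·dist²(I + εE, 𝓤_ε) = dist²(E, 𝓜), where dist denotes the distance with respect to the Frobenius norm on d×d matrices. -/

import Mathlib

open Matrix Filter Topology

noncomputable section

/-- Frobenius norm of a real `d × d` matrix. -/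
def frob {d : ℕ} (F : Matrix (Fin d) (Fin d) ℝ) : ℝ :=
  Real.sqrt (∑ i, ∑ j, (F i j) ^ 2)

/-- Distance (w.r.t. the Frobenius norm) from a matrix to a set of matrices. -/
def fdist {d : ℕ} (F : Matrix (Fin d) (Fin d) ℝ)
    (S : Set (Matrix (Fin d) (Fin d) ℝ)) : ℝ :=
  sInf ((fun G => frob (F - G)) '' S)

/-- The special orthogonal group `SO(d)` as a set of matrices. -/
def SOd (d : ℕ) : Set (Matrix (Fin d) (Fin d) ℝ) :=
  {R | R * Rᵀ = 1 ∧ R.det = 1}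

section Frobenius

attribute [local instance] Matrix.frobeniusNormedRing Matrix.frobeniusNormedAlgebra

theorem frob_eq_norm {d : ℕ} (F : Matrix (Fin d) (Fin d) ℝ) : frob F = ‖F‖ := by
  rw [frob, Matrix.frobenius_norm_def, Real.sqrt_eq_rpow]
  simp

theorem frob_add_le {d : ℕ} (F G : Matrix (Fin d) (Fin d) ℝ) :
    frob (F + G) ≤ frob F + frob G := by
  simpa only [frob_eq_norm] using norm_add_le F G

theorem frob_mul_le {d : ℕ} (F G : Matrix (Fin d) (Fin d) ℝ) :
    frob (F * G) ≤ frob F * frob G := by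
  simpa only [frob_eq_norm] using norm_mul_le F G

theorem frob_neg {d : ℕ} (F : Matrix (Fin d) (Fin d) ℝ) : frob (-F) = frob F := by
  simp only [frob_eq_norm, norm_neg]

theorem frob_smul {d : ℕ} (c : ℝ) (F : Matrix (Fin d) (Fin d) ℝ) :
    frob (c • F) = |c| * frob F := by
  simp only [frob_eq_norm, norm_smul, Real.norm_eq_abs]

theorem frob_transpose {d : ℕ} (F : Matrix (Fin d) (Fin d) ℝ) : frob Fᵀ = frob F := by
  simp only [frob_eq_norm, Matrix.frobenius_norm_transpose]

end Frobenius

theorem frob_nonneg {d : ℕ} (F : Matrix (Fin d) (Fin d) ℝ) : 0 ≤ frob F :=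
  Real.sqrt_nonneg _

theorem continuous_frob {d : ℕ} :
    Continuous (frob : Matrix (Fin d) (Fin d) ℝ → ℝ) := by
  unfold frob
  fun_prop

theorem frob_sq {d : ℕ} (F : Matrix (Fin d) (Fin d) ℝ) :
    frob F ^ 2 = (F * Fᵀ).trace := by
  rw [frob, Real.sq_sqrt (by positivity)]
  simp [Matrix.trace, Matrix.mul_apply, sq]

theorem abs_trace_mul_le {d : ℕ} (F G : Matrix (Fin d) (Fin d) ℝ) :
    |(F * G).trace| ≤ frob F * frob G := by
  rw [← frob_transpose G]
  apply abs_le_of_sq_le_sq _ (mul_nonneg (frob_nonneg _) (frob_nonneg _))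
  have h := Finset.sum_mul_sq_le_sq_mul_sq (Finset.univ : Finset (Fin d × Fin d))
    (fun p => F p.1 p.2) (fun p => Gᵀ p.1 p.2)
  simp only [Fintype.sum_prod_type] at h
  rw [mul_pow, frob, frob, Real.sq_sqrt (by positivity), Real.sq_sqrt (by positivity)]
  simpa [Matrix.trace, Matrix.mul_apply] using h

/-- For symmetric `A`, `B` and orthogonal `R`, the cost of replacing `B` by `R * B`. -/
theorem frob_sub_rotation_sq {d : ℕ} {A B R : Matrix (Fin d) (Fin d) ℝ}
    (hA : A.IsSymm) (hB : B.IsSymm) (hR : R * Rᵀ = 1) :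
    frob (A - R * B) ^ 2 = frob (A - B) ^ 2 + 2 * ((1 - R) * (B * A)).trace := by
  have hR' : Rᵀ * R = 1 := mul_eq_one_comm.mp hR
  have h1 : (A * (B * Rᵀ)).trace = (R * (B * A)).trace := by
    rw [← Matrix.trace_transpose]
    simp [Matrix.transpose_mul, hA.eq, hB.eq, Matrix.mul_assoc]
  have h2 : (R * (B * (B * Rᵀ))).trace = (B * B).trace := by
    rw [Matrix.trace_mul_comm]
    simp [Matrix.mul_assoc, hR']
  have h3 : (A * B).trace = (B * A).trace := Matrix.trace_mul_comm _ _
  rw [frob_sq, frob_sq]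
  simp only [Matrix.transpose_sub, Matrix.transpose_mul, hA.eq, hB.eq, Matrix.sub_mul,
    Matrix.mul_sub, Matrix.trace_sub, Matrix.mul_assoc, Matrix.one_mul, h1, h2, h3]
  ring

theorem one_sub_mul_transpose {d : ℕ} {R : Matrix (Fin d) (Fin d) ℝ} (hR : R * Rᵀ = 1) :
    (1 - R) * (1 - R)ᵀ = (1 - R) + (1 - R)ᵀ := by
  simp only [Matrix.transpose_sub, Matrix.transpose_one, Matrix.sub_mul, Matrix.mul_sub,
    Matrix.one_mul, Matrix.mul_one, hR]
  abel

theorem two_mul_trace_one_sub_mul {d : ℕ} {R S : Matrix (Fin d) (Fin d) ℝ}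
    (hR : R * Rᵀ = 1) (hS : S.IsSymm) :
    2 * ((1 - R) * S).trace = ((1 - R) * (1 - R)ᵀ * S).trace := by
  have h : ((1 - R)ᵀ * S).trace = ((1 - R) * S).trace := by
    rw [← Matrix.trace_transpose, Matrix.transpose_mul, Matrix.transpose_transpose, hS.eq,
      Matrix.trace_mul_comm]
  rw [one_sub_mul_transpose hR, Matrix.add_mul, Matrix.trace_add, h]
  ring

/-- Rotating one of two symmetric perturbations of the identity of size `ε` can decrease their
distance by at most a term of order `ε ^ 2`. -/
theorem frob_sub_rotation_ge {d : ℕ} {E V R : Matrix (Fin d) (Fin d) ℝ} {ε K : ℝ}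
    (hE : E.IsSymm) (hV : V.IsSymm) (hR : R * Rᵀ = 1) (hε : 0 < ε)
    (hEK : frob E ≤ K) (hVK : frob V ≤ K) (hεK : ε * K ≤ 1 / 4) :
    ε * (frob (E - V) - 2 * ε * K ^ 2) ≤ frob (1 + ε • E - R * (1 + ε • V)) := by
  have hK : 0 ≤ K := (frob_nonneg E).trans hEK
  have hA : (1 + ε • E).IsSymm := Matrix.isSymm_one.add (hE.smul ε)
  have hB : (1 + ε • V).IsSymm := Matrix.isSymm_one.add (hV.smul ε)
  have hdiff : (1 + ε • E) - (1 + ε • V) = ε • (E - V) := by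
    rw [smul_sub]; abel
  have hexp : (1 + ε • V) * (1 + ε • E) = 1 + ε • (V + E) + ε ^ 2 • (V * E) := by
    simp only [Matrix.add_mul, Matrix.mul_add, Matrix.one_mul, Matrix.mul_one,
      Matrix.smul_mul, Matrix.mul_smul, smul_add, smul_smul, sq]
    abel
  have hmain := frob_sub_rotation_sq hA hB hR
  rw [hdiff, frob_smul, abs_of_pos hε, hexp, Matrix.mul_add (1 - R), Matrix.mul_add (1 - R), Matrix.mul_smul,
    Matrix.mul_smul, Matrix.trace_add, Matrix.trace_add, Matrix.trace_smul, Matrix.trace_smul,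
    smul_eq_mul, smul_eq_mul] at hmain
  have h1 := two_mul_trace_one_sub_mul hR Matrix.isSymm_one
  rw [Matrix.mul_one ((1 - R) * (1 - R)ᵀ), ← frob_sq] at h1
  have h2 := two_mul_trace_one_sub_mul hR (hV.add hE)
  have h3 := abs_trace_mul_le ((1 - R) * (1 - R)ᵀ) (V + E)
  have h4 : frob ((1 - R) * (1 - R)ᵀ) * frob (V + E) ≤ frob (1 - R) ^ 2 * (2 * K) := by
    have h5 := frob_mul_le (1 - R) (1 - R)ᵀ
    rw [frob_transpose, ← sq] at h5
    have h6 := frob_add_le V E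
    exact mul_le_mul h5 (by linarith) (frob_nonneg _) (sq_nonneg _)
  have h7 := abs_trace_mul_le (1 - R) (V * E)
  have h8 : frob (1 - R) * frob (V * E) ≤ frob (1 - R) * K ^ 2 := by
    refine mul_le_mul_of_nonneg_left ((frob_mul_le V E).trans ?_) (frob_nonneg _)
    rw [sq]
    exact mul_le_mul hVK hEK (frob_nonneg _) hK
  set n := frob (1 - R)
  have h9 : -(n ^ 2 * (2 * K)) ≤ 2 * ((1 - R) * (V + E)).trace := by
    rw [h2]; linarith [neg_abs_le (((1 - R) * (1 - R)ᵀ * (V + E)).trace)]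
  have h10 : -(n * K ^ 2) ≤ ((1 - R) * (V * E)).trace := by
    linarith [neg_abs_le (((1 - R) * (V * E)).trace)]
  have h11 := mul_le_mul_of_nonneg_left h9 hε.le
  have h12 := mul_le_mul_of_nonneg_left h10 (sq_nonneg ε)
  have h13 : n ^ 2 * (ε * K) ≤ n ^ 2 * (1 / 4) :=
    mul_le_mul_of_nonneg_left hεK (sq_nonneg n)
  have h14 : (ε * frob (E - V)) ^ 2 ≤
      frob (1 + ε • E - R * (1 + ε • V)) ^ 2 + (2 * ε ^ 2 * K ^ 2) ^ 2 := by
    rw [hmain]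
    nlinarith [sq_nonneg (n - 2 * ε ^ 2 * K ^ 2), sq_nonneg (ε ^ 2 * K ^ 2)]
  have h15 : 0 ≤ 2 * ε ^ 2 * K ^ 2 := by positivity
  have h16 : ε * frob (E - V) ≤ frob (1 + ε • E - R * (1 + ε • V)) + 2 * ε ^ 2 * K ^ 2 := by
    refine (abs_le_of_sq_le_sq' ?_ (add_nonneg (frob_nonneg _) h15)).2
    nlinarith [mul_nonneg (frob_nonneg (1 + ε • E - R * (1 + ε • V))) h15]
  linarith [h16, show ε * (frob (E - V) - 2 * ε * K ^ 2) =
    ε * frob (E - V) - 2 * ε ^ 2 * K ^ 2 by ring]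

theorem fdist_le {d : ℕ} {F G : Matrix (Fin d) (Fin d) ℝ}
    {S : Set (Matrix (Fin d) (Fin d) ℝ)} (hG : G ∈ S) : fdist F S ≤ frob (F - G) :=
  csInf_le ⟨0, by rintro _ ⟨H, -, rfl⟩; exact frob_nonneg _⟩ ⟨G, hG, rfl⟩

theorem le_fdist {d : ℕ} {F : Matrix (Fin d) (Fin d) ℝ}
    {S : Set (Matrix (Fin d) (Fin d) ℝ)} (hS : S.Nonempty) {c : ℝ}
    (h : ∀ G ∈ S, c ≤ frob (F - G)) : c ≤ fdist F S :=
  le_csInf (hS.image _) (by rintro _ ⟨G, hG, rfl⟩; exact h G hG)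

/-- if `𝓜` is a nonempty compact set of symmetric matrices and
`𝓤_ε = { R (I + εU + r(ε,U)) : R ∈ SO(d), U ∈ 𝓜 }` with `sup_{U∈𝓜} ‖r(ε,U)‖/ε → 0` as
`ε → 0⁺`, then for every symmetric `E`,
`(1/ε²) dist²(I + εE, 𝓤_ε) → dist²(E, 𝓜)` as `ε → 0⁺`. -/
theorem dist_sq_limit (d : ℕ) (hd : 1 ≤ d)
    (M : Set (Matrix (Fin d) (Fin d) ℝ)) (hMne : M.Nonempty)
    (hMcpt : IsCompact M) (hMsym : ∀ U ∈ M, U.IsSymm)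
    (r : ℝ → Matrix (Fin d) (Fin d) ℝ → Matrix (Fin d) (Fin d) ℝ)
    (hrsym : ∀ ε > (0 : ℝ), ∀ U ∈ M, (r ε U).IsSymm)
    (hr : ∀ δ > (0 : ℝ), ∃ ε₀ > (0 : ℝ), ∀ ε : ℝ, 0 < ε → ε < ε₀ →
      ∀ U ∈ M, frob (r ε U) ≤ δ * ε)
    (E : Matrix (Fin d) (Fin d) ℝ) (hE : E.IsSymm) :
    Tendsto (fun ε : ℝ =>
        (1 / ε ^ 2) *
          (fdist (1 + ε • E)
            {G | ∃ R ∈ SOd d, ∃ U ∈ M, G = R * (1 + ε • U + r ε U)}) ^ 2)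
      (𝓝[>] 0) (𝓝 ((fdist E M) ^ 2)) := by
  have hone : (1 : Matrix (Fin d) (Fin d) ℝ) ∈ SOd d := by simp [SOd]
  obtain ⟨K₀, hK₀⟩ := (hMcpt.image continuous_frob).bddAbove
  obtain ⟨K, hK1, hKE, hKM⟩ : ∃ K : ℝ, 1 ≤ K ∧ frob E ≤ K ∧ ∀ U ∈ M, frob U + 1 ≤ K := by
    refine ⟨max 1 (max (frob E) (K₀ + 1)), le_max_left _ _, by simp, fun U hU => ?_⟩
    have := hK₀ ⟨U, hU, rfl⟩
    exact (by linarith : frob U + 1 ≤ K₀ + 1).trans (by simp)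
  have hquot : Tendsto (fun ε : ℝ => fdist (1 + ε • E)
      {G | ∃ R ∈ SOd d, ∃ U ∈ M, G = R * (1 + ε • U + r ε U)} / ε)
      (𝓝[>] 0) (𝓝 (fdist E M)) := by
    rw [Metric.tendsto_nhds]
    intro η hη
    obtain ⟨ε₀, hε₀, hrε⟩ := hr (min 1 (η / 4)) (by positivity)
    have hε₁ : 0 < min ε₀ (min (1 / (4 * K)) (η / (8 * K ^ 2))) := by positivity
    filter_upwards [Ioo_mem_nhdsGT hε₁] with ε hε
    obtain ⟨hε, hlt⟩ := hε
    rw [lt_min_iff, lt_min_iff, lt_div_iff₀ (by positivity), lt_div_iff₀ (by positivity)] at hlt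
    obtain ⟨hlt0, hlt1, hlt2⟩ := hlt
    have hsub : ∀ U ∈ M, ∃ W : Matrix (Fin d) (Fin d) ℝ, W.IsSymm ∧ frob W ≤ 1 ∧
        frob W ≤ η / 4 ∧ 1 + ε • U + r ε U = 1 + ε • (U + W) := by
      intro U hU
      have hW : frob (ε⁻¹ • r ε U) ≤ min 1 (η / 4) := by
        rw [frob_smul, abs_of_pos (inv_pos.mpr hε), inv_mul_le_iff₀ hε, mul_comm]
        exact hrε ε hε hlt0 U hU
      refine ⟨ε⁻¹ • r ε U, (hrsym ε hε U hU).smul _, hW.trans (min_le_left _ _),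
        hW.trans (min_le_right _ _), ?_⟩
      rw [smul_add, smul_smul, mul_inv_cancel₀ hε.ne', one_smul, add_assoc]
    have hmem : ∀ U ∈ M, 1 * (1 + ε • U + r ε U) ∈
        {G | ∃ R ∈ SOd d, ∃ U ∈ M, G = R * (1 + ε • U + r ε U)} :=
      fun U hU => ⟨1, hone, U, hU, rfl⟩
    have hlower : ε * (fdist E M - η / 2) ≤ fdist (1 + ε • E)
        {G | ∃ R ∈ SOd d, ∃ U ∈ M, G = R * (1 + ε • U + r ε U)} := by
      obtain ⟨U₀, hU₀⟩ := hMne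
      refine le_fdist ⟨_, hmem U₀ hU₀⟩ ?_
      rintro _ ⟨R, hR, U, hU, rfl⟩
      obtain ⟨W, hWs, hW1, hWη, hWeq⟩ := hsub U hU
      rw [hWeq]
      refine le_trans (mul_le_mul_of_nonneg_left ?_ hε.le)
        (frob_sub_rotation_ge hE ((hMsym U hU).add hWs) hR.1 hε hKE
          ((frob_add_le U W).trans (by linarith [hKM U hU])) (by linarith))
      have h1 : fdist E M ≤ frob (E - U) := fdist_le hU
      have h2 := frob_add_le (E - (U + W)) W
      rw [show E - (U + W) + W = E - U by abel] at h2
      linarith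
    have hupper : fdist (1 + ε • E)
        {G | ∃ R ∈ SOd d, ∃ U ∈ M, G = R * (1 + ε • U + r ε U)} / ε - η / 4 ≤ fdist E M := by
      refine le_fdist hMne fun U hU => ?_
      obtain ⟨W, -, -, hWη, hWeq⟩ := hsub U hU
      rw [sub_le_iff_le_add, div_le_iff₀' hε]
      refine (fdist_le (hmem U hU)).trans ?_
      rw [hWeq, Matrix.one_mul, show 1 + ε • E - (1 + ε • (U + W)) = ε • ((E - U) + -W) by
        simp only [smul_add, smul_sub, smul_neg]; abel, frob_smul, abs_of_pos hε]
      refine mul_le_mul_of_nonneg_left ?_ hε.le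
      have h := frob_add_le (E - U) (-W)
      rw [frob_neg] at h
      linarith
    rw [← le_div_iff₀' hε] at hlower
    rw [Real.dist_eq, abs_lt]
    constructor <;> linarith
  refine (hquot.pow 2).congr fun ε => ?_
  rw [div_pow]
  ring
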